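/- For every m ≥ 1 the function ((1+z)/(1−z))^m is analytic on the unit disc |z| < 1 with Taylor expansion ((1+z)/(1−z))^m = 1 + Σ_{k≥1} a_k^m (2mz)^k, and the coefficients a_k^m satisfy: (i) 0 < a_k^m < e² for all k ≥ 1; and (ii) |a_k^m − 1/k!| ≤ e^{k+1}/m for all k with 1 ≤ k ≤ m. -/

import Mathlib

open Complex

open PowerSeries in
/-- The Taylor series of `(1 + z) / (1 - z)`. -/
noncomputable def cayleySeries : PowerSeries ℝ := (1 + X) * PowerSeries.mk 1

open PowerSeries in
lemma cayleySeries_mul_one_sub : cayleySeries * (1 - X) = 1 + X := by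
  rw [cayleySeries, mul_assoc, mk_one_mul_one_sub_eq_one, mul_one]

open PowerSeries in
lemma derivative_cayleySeries :
    derivative ℝ cayleySeries * (1 - X ^ 2) = 2 * cayleySeries := by
  have h := cayleySeries_mul_one_sub
  have hd := congrArg (derivative ℝ) h
  simp only [Derivation.leibniz, map_sub, map_add, Derivation.map_one_eq_zero,
    derivative_X, smul_eq_mul] at hd
  have hne : (1 - X : PowerSeries ℝ) ≠ 0 := fun h0 => by
    simpa using congrArg (coeff 0) h0
  apply mul_right_cancel₀ hne
  linear_combination (1 - X ^ 2) * hd + (1 + X - 2) * h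

open PowerSeries in
lemma derivative_cayleySeries_pow (m : ℕ) :
    derivative ℝ (cayleySeries ^ m) * (1 - X ^ 2) = C (2 * (m : ℝ)) * cayleySeries ^ m := by
  cases m with
  | zero => simp
  | succ n =>
    rw [Derivation.leibniz_pow, nsmul_eq_mul, smul_eq_mul, Nat.add_sub_cancel]
    have h := derivative_cayleySeries
    simp only [map_mul, map_natCast, map_ofNat]
    linear_combination ((n + 1 : ℕ) : PowerSeries ℝ) * cayleySeries ^ n * h

open PowerSeries in
lemma coeff_zero_cayleySeries_pow (m : ℕ) : coeff 0 (cayleySeries ^ m) = 1 := by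
  have h : constantCoeff (PowerSeries.mk 1 : PowerSeries ℝ) = 1 := by
    rw [← coeff_zero_eq_constantCoeff_apply, coeff_mk, Pi.one_apply]
  simp [cayleySeries, h]

open PowerSeries in
lemma coeff_one_cayleySeries_pow (m : ℕ) : coeff 1 (cayleySeries ^ m) = 2 * m := by
  have h := congrArg (coeff 0) (derivative_cayleySeries_pow m)
  rw [coeff_C_mul, coeff_zero_cayleySeries_pow, mul_sub, map_sub, mul_one,
    coeff_mul_X_pow', coeff_derivative] at h
  simpa using h

open PowerSeries in
lemma coeff_add_two_cayleySeries_pow (m k : ℕ) :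
    (k + 2) * coeff (k + 2) (cayleySeries ^ m) =
      2 * m * coeff (k + 1) (cayleySeries ^ m) + k * coeff k (cayleySeries ^ m) := by
  have h := congrArg (coeff (k + 1)) (derivative_cayleySeries_pow m)
  rw [coeff_C_mul, mul_sub, map_sub, mul_one, coeff_mul_X_pow', coeff_derivative] at h
  cases k with
  | zero => simp at h ⊢; linarith
  | succ n =>
    rw [if_pos (by omega), show n + 1 + 1 - 2 = n by omega, coeff_derivative] at h
    push_cast at h ⊢
    linarith

/-- The series `p` converges absolutely at `z`, with sum `w`. -/
def AbsHasSumAt (p : PowerSeries ℝ) (z w : ℂ) : Prop :=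
  Summable (fun n => ‖(p.coeff n : ℂ) * z ^ n‖) ∧ HasSum (fun n => (p.coeff n : ℂ) * z ^ n) w

lemma AbsHasSumAt.mul {p q : PowerSeries ℝ} {z v w : ℂ} (hp : AbsHasSumAt p z v)
    (hq : AbsHasSumAt q z w) : AbsHasSumAt (p * q) z (v * w) := by
  have key : (fun n => ((p * q).coeff n : ℂ) * z ^ n) = fun n =>
      ∑ kl ∈ Finset.HasAntidiagonal.antidiagonal n,
        ((p.coeff kl.1 : ℂ) * z ^ kl.1) * ((q.coeff kl.2 : ℂ) * z ^ kl.2) := by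
    funext n
    rw [PowerSeries.coeff_mul]
    push_cast
    rw [Finset.sum_mul]
    refine Finset.sum_congr rfl fun kl hkl => ?_
    rw [← Finset.HasAntidiagonal.mem_antidiagonal.mp hkl, pow_add]
    ring
  have hs := summable_norm_sum_mul_antidiagonal_of_summable_norm hp.1 hq.1
  have ht := tsum_mul_tsum_eq_tsum_sum_antidiagonal_of_summable_norm hp.1 hq.1
  rw [hp.2.tsum_eq, hq.2.tsum_eq] at ht
  refine ⟨?_, ?_⟩
  · exact hs.congr fun n => congrArg norm (congrFun key n).symm
  · rw [key, ht]
    exact hs.of_norm.hasSum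

lemma absHasSumAt_one (z : ℂ) : AbsHasSumAt 1 z 1 := by
  have h : ∀ n ∉ ({0} : Finset ℕ), (((1 : PowerSeries ℝ).coeff n : ℝ) : ℂ) * z ^ n = 0 := by
    intro n hn
    simp at hn
    simp [PowerSeries.coeff_one, hn]
  refine ⟨summable_of_ne_finset_zero (s := {0}) fun n hn => by rw [h n hn, norm_zero], ?_⟩
  simpa using hasSum_sum_of_ne_finset_zero h

lemma absHasSumAt_one_add_X (z : ℂ) : AbsHasSumAt (1 + PowerSeries.X) z (1 + z) := by
  have h : ∀ n ∉ Finset.range 2,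
      (((1 + PowerSeries.X : PowerSeries ℝ).coeff n : ℝ) : ℂ) * z ^ n = 0 := by
    intro n hn
    simp at hn
    simp [PowerSeries.coeff_one, PowerSeries.coeff_X, show n ≠ 0 by omega, show n ≠ 1 by omega]
  refine ⟨summable_of_ne_finset_zero (s := Finset.range 2) fun n hn => by
    rw [h n hn, norm_zero], ?_⟩
  simpa [Finset.sum_range_succ, PowerSeries.coeff_one, PowerSeries.coeff_X] using
    hasSum_sum_of_ne_finset_zero h

lemma absHasSumAt_mk_one {z : ℂ} (hz : ‖z‖ < 1) :
    AbsHasSumAt (PowerSeries.mk 1) z (1 - z)⁻¹ := by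
  constructor
  · simpa using summable_geometric_of_lt_one (norm_nonneg z) hz
  · simpa using hasSum_geometric_of_norm_lt_one hz

lemma absHasSumAt_cayleySeries_pow {z : ℂ} (hz : ‖z‖ < 1) (m : ℕ) :
    AbsHasSumAt (cayleySeries ^ m) z (((1 + z) / (1 - z)) ^ m) := by
  induction m with
  | zero => simpa using absHasSumAt_one z
  | succ n ih =>
    rw [pow_succ, pow_succ]
    exact ih.mul ((absHasSumAt_one_add_X z).mul (absHasSumAt_mk_one hz))

/-- The coefficients of `((1 + z) / (1 - z)) ^ m` as a series in `2 * m * z`. -/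
noncomputable def cayleyCoeff (m k : ℕ) : ℝ := (cayleySeries ^ m).coeff k / (2 * m) ^ k

lemma cayleyCoeff_zero (m : ℕ) : cayleyCoeff m 0 = 1 := by
  simp only [cayleyCoeff, coeff_zero_cayleySeries_pow, pow_zero, div_one]

lemma cayleyCoeff_one {m : ℕ} (hm : 1 ≤ m) : cayleyCoeff m 1 = 1 := by
  have : (m : ℝ) ≠ 0 := by positivity
  rw [cayleyCoeff, coeff_one_cayleySeries_pow, pow_one, div_self (by positivity)]

lemma cayleyCoeff_add_two {m : ℕ} (hm : 1 ≤ m) (k : ℕ) :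
    (k + 2) * cayleyCoeff m (k + 2) =
      cayleyCoeff m (k + 1) + k / (4 * m ^ 2) * cayleyCoeff m k := by
  have : (m : ℝ) ≠ 0 := by positivity
  have h := coeff_add_two_cayleySeries_pow m k
  simp only [cayleyCoeff]
  rw [← mul_div_assoc, h]
  field_simp
  ring

lemma cayleyCoeff_pos {m : ℕ} (hm : 1 ≤ m) (k : ℕ) : 0 < cayleyCoeff m k := by
  induction k using Nat.twoStepInduction with
  | zero => simp [cayleyCoeff_zero]
  | one => simp [cayleyCoeff_one hm]
  | more k h₀ h₁ =>
    have h := cayleyCoeff_add_two hm k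
    have : 0 < (k + 2) * cayleyCoeff m (k + 2) := by rw [h]; positivity
    exact pos_of_mul_pos_right this (by positivity)

lemma cayleyCoeff_le_one {m : ℕ} (hm : 1 ≤ m) (k : ℕ) : cayleyCoeff m k ≤ 1 := by
  induction k using Nat.twoStepInduction with
  | zero => simp [cayleyCoeff_zero]
  | one => simp [cayleyCoeff_one hm]
  | more k h₀ h₁ =>
    have h := cayleyCoeff_add_two hm k
    have hm' : (1 : ℝ) ≤ m := by exact_mod_cast hm
    have hk : (k : ℝ) / (4 * m ^ 2) ≤ k := div_le_self (by positivity) (by nlinarith)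
    have hmul : (k : ℝ) / (4 * m ^ 2) * cayleyCoeff m k ≤ k * 1 :=
      mul_le_mul hk h₀ (cayleyCoeff_pos hm k).le (by positivity)
    have hk₀ : (0 : ℝ) ≤ k := by positivity
    nlinarith

lemma abs_cayleyCoeff_sub_le {m : ℕ} (hm : 1 ≤ m) (k : ℕ) :
    |cayleyCoeff m k - 1 / (k.factorial : ℝ)| ≤ 1 / m := by
  have hm' : (1 : ℝ) ≤ m := by exact_mod_cast hm
  suffices h : ∀ k, |cayleyCoeff m (k + 1) - 1 / ((k + 1).factorial : ℝ)| ≤ 1 / m by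
    cases k with
    | zero => simp [cayleyCoeff_zero]
    | succ k => exact h k
  intro k
  induction k with
  | zero => simp [cayleyCoeff_one hm]
  | succ k ih =>
    have hk₀ : (0 : ℝ) ≤ k := by positivity
    have h := cayleyCoeff_add_two hm k
    have hfac : (k + 2) * (1 / ((k + 1 + 1).factorial : ℝ)) = 1 / ((k + 1).factorial : ℝ) := by
      rw [Nat.factorial_succ (k + 1)]
      push_cast
      field_simp
      ring
    have hnonneg : 0 ≤ (k : ℝ) / (4 * m ^ 2) * cayleyCoeff m k :=
      mul_nonneg (by positivity) (cayleyCoeff_pos hm k).le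
    have hle : (k : ℝ) / (4 * m ^ 2) * cayleyCoeff m k ≤ k * (1 / m) := by
      refine (mul_le_of_le_one_right (by positivity) (cayleyCoeff_le_one hm k)).trans ?_
      rw [mul_one_div]
      exact div_le_div_of_nonneg_left hk₀ (by positivity) (by nlinarith)
    have hpos : 0 < 1 / (m : ℝ) := by positivity
    rw [abs_le] at ih ⊢
    have hk₂ : (0 : ℝ) < k + 2 := by positivity
    constructor
    · refine le_of_mul_le_mul_left ?_ hk₂
      nlinarith
    · refine le_of_mul_le_mul_left ?_ hk₂
      nlinarith

/-- For `m ≥ 1`, the function `((1+z)/(1-z))^m` is analytic on the unit disc `|z| < 1`, with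
Taylor expansion `((1+z)/(1-z))^m = 1 + Σ_{k≥1} a_k^m (2mz)^k` there, where the coefficients
`a_k^m` satisfy `0 < a_k^m < e²` for all `k ≥ 1` and `|a_k^m − 1/k!| ≤ e^{k+1}/m` for
`1 ≤ k ≤ m`. -/
theorem taylor_coefficients_abounds (m : ℕ) (hm : 1 ≤ m) :
    AnalyticOnNhd ℂ (fun z : ℂ => ((1 + z) / (1 - z)) ^ m) (Metric.ball (0 : ℂ) 1) ∧
    ∃ a : ℕ → ℝ,
      (∀ z : ℂ, ‖z‖ < 1 →
        HasSum (fun k : ℕ => ((a (k + 1) : ℝ) : ℂ) * (2 * (m : ℂ) * z) ^ (k + 1))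
          (((1 + z) / (1 - z)) ^ m - 1)) ∧
      (∀ k : ℕ, 1 ≤ k → 0 < a k ∧ a k < Real.exp 2) ∧
      (∀ k : ℕ, 1 ≤ k → k ≤ m →
        |a k - 1 / (k.factorial : ℝ)| ≤ Real.exp ((k : ℝ) + 1) / (m : ℝ)) := by
  have hm₀ : (m : ℂ) ≠ 0 := by exact_mod_cast (by omega : m ≠ 0)
  refine ⟨fun z hz => ?_, cayleyCoeff m, fun z hz => ?_,
    fun k _ => ⟨cayleyCoeff_pos hm k, (cayleyCoeff_le_one hm k).trans_lt (by simp)⟩,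
    fun k _ _ => (abs_cayleyCoeff_sub_le hm k).trans ?_⟩
  · have hne : 1 - z ≠ 0 := fun h => by
      rw [← sub_eq_zero.mp h] at hz
      simp at hz
    fun_prop (disch := exact hne)
  · have h := (hasSum_nat_add_iff' 1).mpr (absHasSumAt_cayleySeries_pow hz m).2
    simp only [Finset.sum_range_one, coeff_zero_cayleySeries_pow, pow_zero, ofReal_one,
      mul_one] at h
    refine h.congr_fun fun k => ?_
    simp only [cayleyCoeff]
    push_cast
    rw [mul_pow _ z]
    field_simp
  · gcongr
    exact Real.one_le_exp (by positivity)
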